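/- There exists a constant C > 0, depending only on K and sup |ω₀|, such that for all z₁ ∈ ℝ and all t ≥ 0: Φ(z₁,t) ≤ C e^{Ct}. -/

import Mathlib

open MeasureTheory Real

/-- `IsGlobalSolution ω₀ Φ`: `Φ` is a global solution of the hyperbolic 2D Euler
equation in `z`-coordinates with data `ω₀`: it is continuous on `ℝ × [0,∞)`, bounded
on `ℝ × [0,T]` for every `T > 0`, and with `ω(z₁,z₂,t) := ω₀(z₁, z₂ - Φ(z₁,t))` it
satisfies `Φ(z₁,t) = (1/2)∫₀ᵗ ∫_{z₁}^∞ ∫_ℝ ω(z̃₁,z₂,s)/cosh(z₂) dz₂ dz̃₁ ds`. -/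
def IsGlobalSolution (ω₀ : ℝ × ℝ → ℝ) (Φ : ℝ → ℝ → ℝ) : Prop :=
  ContinuousOn (fun p : ℝ × ℝ => Φ p.1 p.2) (Set.univ ×ˢ Set.Ici (0:ℝ)) ∧
  (∀ T : ℝ, 0 < T → ∃ M, ∀ z₁ : ℝ, ∀ t ∈ Set.Icc (0:ℝ) T, |Φ z₁ t| ≤ M) ∧
  ∀ (z₁ t : ℝ), 0 ≤ t →
    Φ z₁ t = (1 / 2) * ∫ s in (0:ℝ)..t, ∫ w in Set.Ioi z₁, ∫ z₂ : ℝ,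
      ω₀ (w, z₂ - Φ w s) / Real.cosh z₂

/-- The velocity amplitude
`Ω(z₁,t) = (1/4)∫_{z₁}^∞ ∫_ℝ ω₀(z̃₁, z₂ - Φ(z̃₁,t))/cosh(z₂) dz₂ dz̃₁`. -/
noncomputable def Omeg (ω₀ : ℝ × ℝ → ℝ) (Φ : ℝ → ℝ → ℝ) (z₁ t : ℝ) : ℝ :=
  (1 / 4) * ∫ w in Set.Ioi z₁, ∫ z₂ : ℝ, ω₀ (w, z₂ - Φ w t) / Real.cosh z₂

/-- A fibre integral against `1 / cosh` is small when the fibre is supported in an interval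
of length `2 * K` on which `1 / cosh` is at most `c`. -/
theorem integral_div_cosh_le {f : ℝ → ℝ} {K M c p : ℝ} (hK : 0 ≤ K) (hM : 0 ≤ M) (hc : 0 ≤ c)
    (hf : ∀ z, 0 ≤ f z) (hfM : ∀ z, f z ≤ M) (hsupp : ∀ z, f z ≠ 0 → |p - z| ≤ K)
    (hcosh : ∀ z, |p - z| ≤ K → 1 / cosh z ≤ c) :
    ∫ z, f z / cosh z ≤ 2 * K * M * c := by
  have hle : ∀ z, f z / cosh z ≤ (Set.Icc (p - K) (p + K)).indicator (fun _ => M * c) z := by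
    intro z
    by_cases hz : f z = 0
    · rw [hz, zero_div]
      exact Set.indicator_nonneg (fun _ _ => mul_nonneg hM hc) z
    · have h := hsupp z hz
      have h' := abs_le.mp h
      rw [Set.indicator_of_mem (Set.mem_Icc.mpr ⟨by linarith, by linarith⟩), div_eq_mul_one_div]
      exact mul_le_mul (hfM z) (hcosh z h) (one_div_nonneg.mpr (cosh_pos z).le) hM
  calc ∫ z, f z / cosh z
      ≤ ∫ z, (Set.Icc (p - K) (p + K)).indicator (fun _ => M * c) z :=
        integral_mono_of_nonneg (.of_forall fun z => div_nonneg (hf z) (cosh_pos z).le)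
          ((integrable_indicator_iff measurableSet_Icc).mpr continuous_const.integrableOn_Icc) (.of_forall hle)
    _ = 2 * K * M * c := by
        rw [integral_indicator measurableSet_Icc, setIntegral_const, Real.volume_real_Icc_of_le
          (by linarith), smul_eq_mul]
        ring

theorem one_div_cosh_le_two_mul_exp (z : ℝ) : 1 / cosh z ≤ 2 * exp z := by
  rw [div_le_iff₀ (cosh_pos z), cosh_eq]
  have h : exp z * exp (-z) = 1 := by rw [← exp_add]; simp
  nlinarith [sq_nonneg (exp z)]

/-- Integrated vorticity to the right of `z₁`, when the phase takes values in `[0, A]`. -/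
theorem integral_integral_div_cosh_le {ω₀ : ℝ × ℝ → ℝ} {φ : ℝ → ℝ} {K M A : ℝ} (hK : 0 < K)
    (hM : 0 ≤ M) (hA : 0 ≤ A) (hω : ∀ z, 0 ≤ ω₀ z) (hωM : ∀ z, |ω₀ z| ≤ M)
    (hsupp : ∀ z : ℝ × ℝ, ω₀ z ≠ 0 → |z.1 - z.2| ≤ K ∧ z.1 + z.2 ≤ K)
    (hφA : ∀ w, φ w ≤ A) (z₁ : ℝ) :
    ∫ w in Set.Ioi z₁, ∫ z₂ : ℝ, ω₀ (w, z₂ - φ w) / cosh z₂ ≤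
      2 * K * M * (2 * A + K + 4 * exp (3 * K / 2)) := by
  set h : ℝ → ℝ := fun w => (Set.Ioc (-(2 * A)) K).indicator (fun _ => 2 * K * M) w +
    (Set.Iic K).indicator (fun w => 2 * K * M * (2 * exp K * exp (1 / 2 * w))) w with hdef
  have hKM : 0 ≤ 2 * K * M := by positivity
  have h₁ : Integrable ((Set.Ioc (-(2 * A)) K).indicator fun _ => 2 * K * M) :=
    (integrable_indicator_iff measurableSet_Ioc).mpr continuous_const.integrableOn_Ioc
  have h₂ : Integrable ((Set.Iic K).indicator
      fun w => 2 * K * M * (2 * exp K * exp (1 / 2 * w))) :=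
    (integrable_indicator_iff measurableSet_Iic).mpr
      (((integrableOn_exp_mul_Iic (by norm_num) K).const_mul _).const_mul _)
  have hn₁ : ∀ w, 0 ≤ (Set.Ioc (-(2 * A)) K).indicator (fun _ => 2 * K * M) w :=
    Set.indicator_nonneg fun _ _ => hKM
  have hn₂ : ∀ w, 0 ≤ (Set.Iic K).indicator
      (fun w => 2 * K * M * (2 * exp K * exp (1 / 2 * w))) w :=
    Set.indicator_nonneg fun _ _ => by positivity
  have hle : ∀ w, ∫ z₂ : ℝ, ω₀ (w, z₂ - φ w) / cosh z₂ ≤ h w := by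
    intro w
    have key : ∀ c, 0 ≤ c → (∀ z, |w + φ w - z| ≤ K → 1 / cosh z ≤ c) →
        ∫ z₂ : ℝ, ω₀ (w, z₂ - φ w) / cosh z₂ ≤ 2 * K * M * c := fun c hc hcosh =>
      integral_div_cosh_le hK.le hM hc (fun _ => hω _) (fun _ => (le_abs_self _).trans (hωM _))
        (fun z hz => by
          have := (hsupp _ hz).1
          rwa [show w - (z - φ w) = w + φ w - z by ring] at this) hcosh
    rcases lt_or_ge K w with hw | hw
    · have hz : ∀ z₂, ω₀ (w, z₂ - φ w) = 0 := by
        intro z₂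
        by_contra hne
        obtain ⟨ha, hb⟩ := hsupp _ hne
        have := (abs_le.mp ha).2
        simp only at this hb
        linarith
      simp only [hz, zero_div, integral_zero]
      exact add_nonneg (hn₁ w) (hn₂ w)
    · rcases lt_or_ge (-(2 * A)) w with hw' | hw'
      · refine le_trans ?_ (le_add_of_nonneg_right (hn₂ w))
        rw [Set.indicator_of_mem (Set.mem_Ioc.mpr ⟨hw', hw⟩)]
        simpa using key 1 zero_le_one fun z _ =>
          (div_le_one (cosh_pos z)).mpr (one_le_cosh z)
      · refine le_trans ?_ (le_add_of_nonneg_left (hn₁ w))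
        rw [Set.indicator_of_mem (Set.mem_Iic.mpr hw)]
        refine key _ (by positivity) fun z hz => (one_div_cosh_le_two_mul_exp z).trans ?_
        rw [mul_assoc, ← exp_add]
        gcongr
        have := (abs_le.mp hz).1
        have := hφA w
        linarith
  have hint : Integrable h := h₁.add h₂
  calc ∫ w in Set.Ioi z₁, ∫ z₂ : ℝ, ω₀ (w, z₂ - φ w) / cosh z₂
      ≤ ∫ w in Set.Ioi z₁, h w :=
        integral_mono_of_nonneg (.of_forall fun w => integral_nonneg fun z =>
          div_nonneg (hω _) (cosh_pos z).le) hint.integrableOn (.of_forall hle)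
    _ ≤ ∫ w, h w :=
        setIntegral_le_integral hint (.of_forall fun w => add_nonneg (hn₁ w) (hn₂ w))
    _ = 2 * K * M * (2 * A + K + 4 * exp (3 * K / 2)) := by
        rw [hdef, integral_add h₁ h₂, integral_indicator measurableSet_Ioc,
          integral_indicator measurableSet_Iic, setIntegral_const,
          Real.volume_real_Ioc_of_le (by linarith), integral_const_mul, integral_const_mul,
          integral_exp_mul_Iic (by norm_num), show 3 * K / 2 = K + 1 / 2 * K by ring, exp_add,
          smul_eq_mul]
        ring

/-- A Grönwall-type bound for a family of functions, without measurability assumptions: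
it suffices that the uniform bound `a * exp (2 * C * s)` is reproduced by integration. -/
theorem le_exp_of_forall_le_integral {ι : Type*} {u : ι → ℝ → ℝ} {C T B : ℝ} (hC : 0 < C)
    (hB : ∀ i, ∀ t ∈ Set.Icc 0 T, u i t ≤ B)
    (hu : ∀ a : ℝ, 0 ≤ a → (∀ i, ∀ s ∈ Set.Icc 0 T, u i s ≤ a * exp (2 * C * s)) →
      ∀ i, ∀ t ∈ Set.Icc 0 T, u i t ≤ ∫ s in (0:ℝ)..t, C * (1 + a * exp (2 * C * s)))
    (i : ι) {t : ℝ} (ht : t ∈ Set.Icc 0 T) : u i t ≤ exp (2 * C * t) := by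
  have himp : ∀ a : ℝ, 0 ≤ a → (∀ i, ∀ s ∈ Set.Icc 0 T, u i s ≤ a * exp (2 * C * s)) →
      ∀ i, ∀ s ∈ Set.Icc 0 T, u i s ≤ (1 + a) / 2 * exp (2 * C * s) := by
    intro a ha h i t ht
    have hval : ∫ s in (0:ℝ)..t, C * (1 + a * exp (2 * C * s)) =
        C * t + a / 2 * (exp (2 * C * t) - 1) := by
      have hd : ∀ s ∈ Set.uIcc 0 t, HasDerivAt (fun s => C * s + a / 2 * (exp (2 * C * s) - 1))
          (C * (1 + a * exp (2 * C * s))) s := by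
        intro s _
        have h₁ := (((hasDerivAt_id s).const_mul (2 * C)).exp.sub_const 1).const_mul (a / 2)
        refine (((hasDerivAt_id s).const_mul C).add h₁).congr_deriv ?_
        simp only [id]
        ring
      rw [intervalIntegral.integral_eq_sub_of_hasDerivAt hd
        (Continuous.intervalIntegrable (by fun_prop) _ _)]
      simp
    have h₁ := hu a ha h i t ht
    rw [hval] at h₁
    have h₂ := add_one_le_exp (2 * C * t)
    nlinarith [exp_pos (2 * C * t)]
  set S : Set ℝ := {a | 0 ≤ a ∧ ∀ i, ∀ s ∈ Set.Icc 0 T, u i s ≤ a * exp (2 * C * s)}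
  have hne : S.Nonempty := by
    refine ⟨max B 0, le_max_right _ _, fun i s hs => ((hB i s hs).trans (le_max_left B 0)).trans ?_⟩
    exact le_mul_of_one_le_right (le_max_right _ _)
      (one_le_exp (mul_nonneg (by positivity) hs.1))
  have hbdd : BddBelow S := ⟨0, fun a ha => ha.1⟩
  have hmem : sInf S ∈ S := by
    refine ⟨le_csInf hne fun a ha => ha.1, fun i s hs => ?_⟩
    rw [← div_le_iff₀ (exp_pos _)]
    exact le_csInf hne fun a ha => (div_le_iff₀ (exp_pos _)).mpr (ha.2 i s hs)
  have hle : sInf S ≤ (1 + sInf S) / 2 :=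
    csInf_le hbdd ⟨by linarith [hmem.1], himp _ hmem.1 hmem.2⟩
  refine (hmem.2 i t ht).trans (mul_le_of_le_one_left (exp_pos _).le (by linarith))

/-- Double-exponential a priori bound fails to be needed here: for the hyperbolic 2D
Euler equation, the phase satisfies `Φ(z₁,t) ≤ C e^{Ct}` with `C` depending only on
`K` and the supremum norm bound `M` of `ω₀`. -/
theorem stmt_7 (K M : ℝ) (hK : 0 < K) (hM : 0 ≤ M) :
    ∃ C : ℝ, 0 < C ∧
      ∀ (ω₀ : ℝ × ℝ → ℝ) (Φ : ℝ → ℝ → ℝ),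
        Continuous ω₀ → (∀ z, 0 ≤ ω₀ z) → (∀ z, |ω₀ z| ≤ M) →
        (∀ z : ℝ × ℝ, ω₀ z ≠ 0 → |z.1 - z.2| ≤ K ∧ z.1 + z.2 ≤ K) →
        IsGlobalSolution ω₀ Φ →
        ∀ (z₁ t : ℝ), 0 ≤ t → Φ z₁ t ≤ C * Real.exp (C * t) := by
  set D := K * M * (K + 4 * exp (3 * K / 2) + 2) + 1 with hD
  have hKM : 0 ≤ K * M := by positivity
  have hD1 : 1 ≤ D := le_add_of_nonneg_left (by positivity)
  refine ⟨2 * D, by linarith, fun ω₀ Φ _ hω hωM hsupp hΦ z₁ t ht => ?_⟩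
  obtain ⟨-, hbdd, heq⟩ := hΦ
  obtain ⟨B, hB⟩ := hbdd (t + 1) (by linarith)
  have hG : ∀ z s, 0 ≤ ∫ w in Set.Ioi z, ∫ z₂ : ℝ, ω₀ (w, z₂ - Φ w s) / cosh z₂ :=
    fun z s => integral_nonneg fun w => integral_nonneg fun y =>
      div_nonneg (hω _) (cosh_pos y).le
  have hexp : Φ z₁ t ≤ exp (2 * D * t) := by
    refine le_exp_of_forall_le_integral (T := t + 1) (by linarith)
      (fun z s hs => (le_abs_self _).trans (hB z s hs)) (fun a ha hbound z r hr => ?_) z₁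
      ⟨ht, by linarith⟩
    rw [heq z r hr.1, ← intervalIntegral.integral_const_mul,
      intervalIntegral.integral_of_le hr.1, intervalIntegral.integral_of_le hr.1]
    refine integral_mono_of_nonneg
      (.of_forall fun s => mul_nonneg (by norm_num) (hG z s))
      (Continuous.integrableOn_Ioc (by fun_prop)) ?_
    filter_upwards [ae_restrict_mem measurableSet_Ioc] with s hs
    have hA : 0 ≤ a * exp (2 * D * s) := by positivity
    have h := integral_integral_div_cosh_le hK hM hA hω hωM hsupp
      (fun w => hbound w s ⟨hs.1.le, hs.2.trans hr.2⟩) z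
    have hE := exp_pos (3 * K / 2)
    calc _ ≤ K * M * (2 * (a * exp (2 * D * s)) + K + 4 * exp (3 * K / 2)) := by linarith
      _ ≤ D * (1 + a * exp (2 * D * s)) := by
        generalize a * exp (2 * D * s) = A at hA
        have h₁ : 0 ≤ K * M * ((K + 4 * exp (3 * K / 2)) * A + 2) := by positivity
        rw [hD]
        nlinarith
  exact hexp.trans (le_mul_of_one_le_left (exp_pos _).le (by linarith))
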